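/- In a two-agent market with two trades, if the best response sequence does not terminate and hence eventually cycles, then every row of the cycle contains at least one A and at least one R. -/

import Mathlib

open Finset

/-- A trading market: a set `I` of agents, a set `Ω` of bilateral trades, each with a
buyer and a distinct seller, integer-valued valuations over bundles of trades, and a
(unique, tie-broken) demanded bundle at every price vector. -/
structure Market (I Ω : Type) [DecidableEq I] where
  buyer : Ω → I
  seller : Ω → I
  buyer_ne_seller : ∀ ω, buyer ω ≠ seller ω
  v : I → Finset Ω → ℤ
  demand : I → (Ω → ℤ) → Finset Ω
  demand_involves : ∀ i p, ∀ ω ∈ demand i p, buyer ω = i ∨ seller ω = i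
  demand_max : ∀ (i : I) (p : Ω → ℤ) (Ψ : Finset Ω),
    (∀ ω ∈ Ψ, buyer ω = i ∨ seller ω = i) →
    v i Ψ - ∑ ω ∈ Ψ, (if buyer ω = i then (1 : ℤ) else if seller ω = i then -1 else 0) * p ω ≤
      v i (demand i p) -
        ∑ ω ∈ demand i p,
          (if buyer ω = i then (1 : ℤ) else if seller ω = i then -1 else 0) * p ω

/-- A state of the market dynamic: the set of unsatisfied agents and the current offers
`offers i ω` of agent `i` for trade `ω`. -/
structure MState (I Ω : Type) where
  unsat : Finset I
  offers : I → Ω → ℤ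

namespace Market

variable {I Ω : Type} [Fintype I] [DecidableEq I] [Fintype Ω] [DecidableEq Ω]

/-- The sign `χ^i_ω`: `1` if `i` buys `ω`, `-1` if `i` sells `ω`, `0` otherwise. -/
def chi (M : Market I Ω) (i : I) (ω : Ω) : ℤ :=
  if M.buyer ω = i then 1 else if M.seller ω = i then -1 else 0

/-- Quasilinear utility of agent `i` for bundle `Ψ` at prices `p`. -/
def utility (M : Market I Ω) (i : I) (Ψ : Finset Ω) (p : Ω → ℤ) : ℤ :=
  M.v i Ψ - ∑ ω ∈ Ψ, M.chi i ω * p ω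

/-- The valuation of the empty bundle is `0`. -/
def Normalized (M : Market I Ω) : Prop := ∀ i : I, M.v i (∅ : Finset Ω) = 0

/-- The prices facing agent `i`: the counterpart's offer `σ^{-i}_ω` for each trade `ω`. -/
def price (M : Market I Ω) (σ : I → Ω → ℤ) (i : I) (ω : Ω) : ℤ :=
  if M.buyer ω = i then σ (M.seller ω) ω else σ (M.buyer ω) ω

/-- The best response (with step size `ε = 1`) of agent `i` given current offers `σ`:
she matches the counterpart's offer on the trades she demands, and moves off by `1`
(in her favourable direction) otherwise.  Offers of other agents are unchanged. -/
def bestResponse (M : Market I Ω) (σ : I → Ω → ℤ) (i : I) : I → Ω → ℤ := fun j ω =>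
  if j = i ∧ (M.buyer ω = i ∨ M.seller ω = i) then
    (if ω ∈ M.demand i (M.price σ i) then M.price σ i ω
     else M.price σ i ω - M.chi i ω)
  else σ j ω

/-- One step of the market dynamic: agent `i` best responds, becomes satisfied, and all
counterparts facing a modified offer become unsatisfied. -/
def mstep (M : Market I Ω) (s : MState I Ω) (i : I) : MState I Ω :=
  { unsat := (s.unsat.erase i) ∪ (Finset.univ.filter fun j =>
      j ≠ i ∧ ∃ ω : Ω,
        ((M.buyer ω = i ∧ M.seller ω = j) ∨ (M.buyer ω = j ∧ M.seller ω = i)) ∧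
        M.bestResponse s.offers i i ω ≠ s.offers i ω),
    offers := M.bestResponse s.offers i }

/-- Running the dynamic along a finite sequence of best-responding agents. -/
def mrun (M : Market I Ω) : MState I Ω → List I → MState I Ω
  | s, [] => s
  | s, i :: L => M.mrun (M.mstep s i) L

/-- A best response sequence of the dynamic is valid if every selected agent is
unsatisfied when selected. -/
def ValidSeq (M : Market I Ω) : MState I Ω → List I → Prop
  | _, [] => True
  | s, i :: L => i ∈ s.unsat ∧ M.ValidSeq (M.mstep s i) L

/-- A (valid) best response sequence after which the market dynamic terminates, i.e.,
all agents are satisfied. -/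
def TerminatingSeq (M : Market I Ω) (s : MState I Ω) (L : List I) : Prop :=
  M.ValidSeq s L ∧ (M.mrun s L).unsat = ∅

/-- Full substitutability of the demand of agent `i` (Hatfield et al.). -/
def FullySubstitutable (M : Market I Ω) (i : I) : Prop :=
  ∀ p p' : Ω → ℤ,
    (((∀ ω, M.seller ω = i → p ω = p' ω) ∧ (∀ ω, M.buyer ω = i → p' ω ≤ p ω)) →
      ((∀ ω ∈ M.demand i p, M.seller ω = i → ω ∈ M.demand i p') ∧
       (∀ ω ∈ M.demand i p', M.buyer ω = i → p ω = p' ω → ω ∈ M.demand i p))) ∧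
    (((∀ ω, M.buyer ω = i → p ω = p' ω) ∧ (∀ ω, M.seller ω = i → p ω ≤ p' ω)) →
      ((∀ ω ∈ M.demand i p, M.buyer ω = i → ω ∈ M.demand i p') ∧
       (∀ ω ∈ M.demand i p', M.seller ω = i → p ω = p' ω → ω ∈ M.demand i p)))

/-- A market with fully substitutable agents. -/
def FSM (M : Market I Ω) : Prop := ∀ i : I, M.FullySubstitutable i

end Market

namespace Market

variable {Ω : Type} [Fintype Ω] [DecidableEq Ω]

/-- The alternating best response dynamic of a two-agent market, starting with agent `a`:
`altRun M s a n` is the state after `n` best responses. -/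
def altRun (M : Market Bool Ω) : MState Bool Ω → Bool → ℕ → MState Bool Ω
  | s, _, 0 => s
  | s, a, n + 1 => M.altRun (M.mstep s a) (!a) n

/-- The alternating best response dynamic terminates (all agents become satisfied). -/
def AltConverges (M : Market Bool Ω) (s : MState Bool Ω) (a : Bool) : Prop :=
  ∃ n : ℕ, (M.altRun s a n).unsat = ∅

end Market

/-- The agent performing the `n`-th best response (0-indexed) of the alternating dynamic
started by agent `a`. -/
def altAgent (a : Bool) (n : ℕ) : Bool := if n % 2 = 0 then a else !a

namespace Market

variable {Ω : Type} [Fintype Ω] [DecidableEq Ω]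

/-- The accept/reject column entries of the alternating best response sequence:
`col M s a n ω = true` means the `n`-th best response accepts (demands) trade `ω`
("A"), and `false` means it rejects it ("R"). -/
def col (M : Market Bool Ω) (s : MState Bool Ω) (a : Bool) (n : ℕ) (ω : Ω) : Bool :=
  decide (ω ∈ M.demand (altAgent a n) (M.price (M.altRun s a n).offers (altAgent a n)))

end Market

theorem altAgent_succ (a : Bool) (n : ℕ) : altAgent a (n + 1) = !altAgent a n := by
  unfold altAgent
  rcases Nat.mod_two_eq_zero_or_one n with h | h
  · simp [h, show (n + 1) % 2 = 1 by omega]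
  · simp [h, show (n + 1) % 2 = 0 by omega]

theorem altAgent_add_two_mul (a : Bool) (n k : ℕ) : altAgent a (n + 2 * k) = altAgent a n := by
  simp [altAgent, Nat.add_mul_mod_self_left]

namespace Market

variable {Ω : Type}

theorem buyer_eq_or_seller_eq (M : Market Bool Ω) (i : Bool) (ω : Ω) :
    M.buyer ω = i ∨ M.seller ω = i := by
  have h := M.buyer_ne_seller ω
  revert h
  generalize M.buyer ω = b
  generalize M.seller ω = c
  revert i b c
  decide

theorem chi_not (M : Market Bool Ω) (i : Bool) (ω : Ω) : M.chi (!i) ω = -M.chi i ω := by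
  have h := M.buyer_ne_seller ω
  unfold chi
  revert h
  generalize M.buyer ω = b
  generalize M.seller ω = c
  revert i b c
  decide

theorem chi_mul_self (M : Market Bool Ω) (i : Bool) (ω : Ω) : M.chi i ω * M.chi i ω = 1 := by
  have h := M.buyer_ne_seller ω
  unfold chi
  revert h
  generalize M.buyer ω = b
  generalize M.seller ω = c
  revert i b c
  decide

/-- In a two-agent market an agent faces the offers of the other agent. -/
theorem price_eq_offer_not (M : Market Bool Ω) (σ : Bool → Ω → ℤ) (i : Bool) (ω : Ω) :
    M.price σ i ω = σ (!i) ω := by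
  have h := M.buyer_ne_seller ω
  unfold price
  revert h
  generalize M.buyer ω = b
  generalize M.seller ω = c
  cases i <;> cases b <;> cases c <;> simp

/-- Rejecting an extra trade is optimal only if its price is at least its marginal value. -/
theorem v_insert_sub_le_of_demand_eq [DecidableEq Ω] (M : Market Bool Ω) (i : Bool) (p : Ω → ℤ)
    (D : Finset Ω) (hD : M.demand i p = D) (ω : Ω) (hω : ω ∉ D) :
    M.v i (insert ω D) - M.v i D ≤ M.chi i ω * p ω := by
  have h := M.demand_max i p (insert ω D) fun ω _ => M.buyer_eq_or_seller_eq i ω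
  rw [hD, Finset.sum_insert hω] at h
  change _ - (M.chi i ω * p ω + _) ≤ _ at h
  linarith

theorem bestResponse_self [DecidableEq Ω] (M : Market Bool Ω) (σ : Bool → Ω → ℤ)
    (i : Bool) (ω : Ω) :
    M.bestResponse σ i i ω =
      if ω ∈ M.demand i (M.price σ i) then M.price σ i ω else M.price σ i ω - M.chi i ω := by
  simp [bestResponse, M.buyer_eq_or_seller_eq i ω]

theorem bestResponse_of_ne [DecidableEq Ω] (M : Market Bool Ω) (σ : Bool → Ω → ℤ)
    {i j : Bool} (h : j ≠ i) (ω : Ω) : M.bestResponse σ i j ω = σ j ω := by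
  simp [bestResponse, h]

variable [Fintype Ω] [DecidableEq Ω]

theorem altRun_succ (M : Market Bool Ω) (s : MState Bool Ω) (a : Bool) (n : ℕ) :
    M.altRun s a (n + 1) = M.mstep (M.altRun s a n) (altAgent a n) := by
  induction n generalizing s a with
  | zero => simp [altRun, altAgent]
  | succ n ih =>
    rw [altRun, ih, altRun]
    congr 1
    rw [altAgent_succ]
    unfold altAgent
    split <;> simp

/-- The prices facing the agent who performs the `n`-th best response. -/
def altPrice (M : Market Bool Ω) (s : MState Bool Ω) (a : Bool) (n : ℕ) : Ω → ℤ :=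
  M.price (M.altRun s a n).offers (altAgent a n)

theorem col_eq_true_iff (M : Market Bool Ω) (s : MState Bool Ω) (a : Bool) (n : ℕ) (ω : Ω) :
    M.col s a n ω = true ↔ ω ∈ M.demand (altAgent a n) (M.altPrice s a n) := by
  simp [col, altPrice]

theorem altPrice_succ (M : Market Bool Ω) (s : MState Bool Ω) (a : Bool) (n : ℕ) (ω : Ω) :
    M.altPrice s a (n + 1) ω =
      if M.col s a n ω = true then M.altPrice s a n ω
      else M.altPrice s a n ω - M.chi (altAgent a n) ω := by
  simp only [col_eq_true_iff]
  rw [altPrice, price_eq_offer_not, altAgent_succ, Bool.not_not, altRun_succ]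
  exact M.bestResponse_self _ _ _

theorem altPrice_add_two (M : Market Bool Ω) (s : MState Bool Ω) (a : Bool) (n : ℕ) (ω : Ω) :
    M.altPrice s a (n + 2) ω = M.altPrice s a n ω
      - (if M.col s a n ω = true then 0 else M.chi (altAgent a n) ω)
      + (if M.col s a (n + 1) ω = true then 0 else M.chi (altAgent a n) ω) := by
  rw [altPrice_succ, altPrice_succ, altAgent_succ, chi_not]
  split <;> split <;> ring

/-- If two consecutive columns agree, then the dynamic terminates. -/
theorem altConverges_of_col_eq (M : Market Bool Ω) (s : MState Bool Ω) (a : Bool) (n : ℕ)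
    (h : ∀ ω, M.col s a (n + 1) ω = M.col s a n ω) : M.AltConverges s a := by
  have hp : ∀ ω, M.altPrice s a (n + 2) ω = M.altPrice s a n ω := fun ω => by
    rw [altPrice_add_two, h ω]
    ring
  have hoffer : ∀ ω, M.bestResponse (M.altRun s a (n + 1)).offers (altAgent a (n + 1))
      (altAgent a (n + 1)) ω = (M.altRun s a (n + 1)).offers (altAgent a (n + 1)) ω := by
    intro ω
    have h2 := hp ω
    simp only [altPrice, price_eq_offer_not] at h2
    rw [altAgent_succ a (n + 1), Bool.not_not, altRun_succ M s a (n + 1),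
      ← altAgent_succ] at h2
    refine h2.trans ?_
    rw [altRun_succ M s a n]
    refine (M.bestResponse_of_ne _ ?_ ω).symm
    simp [altAgent_succ]
  refine ⟨n + 2, Finset.eq_empty_of_forall_notMem fun j hj => ?_⟩
  rw [altRun_succ M s a (n + 1)] at hj
  simp only [mstep, Finset.mem_union, Finset.mem_erase, Finset.mem_filter] at hj
  rcases hj with ⟨hj, hmem⟩ | ⟨-, -, ω, -, hω⟩
  · have hji : j = altAgent a n := by
      rw [altAgent_succ] at hj
      revert hj
      cases j <;> cases altAgent a n <;> simp
    rw [altRun_succ] at hmem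
    simp [mstep, hji] at hmem
  · exact hω (hoffer ω)

/-- In a nonterminating two-trade dynamic, no row is eventually constant. -/
theorem exists_col_ne (M : Market Bool (Fin 2)) (s : MState Bool (Fin 2)) (a : Bool)
    (hnt : ¬ M.AltConverges s a) (ω : Fin 2) (N : ℕ) (c : Bool) :
    ∃ n, N ≤ n ∧ M.col s a n ω ≠ c := by
  by_contra! hc
  obtain ⟨τ, hτ, hcover⟩ : ∃ τ, τ ≠ ω ∧ ∀ x, x = ω ∨ x = τ :=
    (by decide : ∀ ω : Fin 2, ∃ τ, τ ≠ ω ∧ ∀ x, x = ω ∨ x = τ) ω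
  have halt : ∀ n, N ≤ n → M.col s a (n + 1) τ = !M.col s a n τ := by
    intro n hn
    by_contra hne
    refine hnt (M.altConverges_of_col_eq s a n fun x => ?_)
    rcases hcover x with rfl | rfl
    · rw [hc n hn, hc (n + 1) (by omega)]
    · simpa using hne
  obtain ⟨m, hm, hrej⟩ : ∃ m, N ≤ m ∧ M.col s a m τ = false := by
    cases h : M.col s a N τ
    · exact ⟨N, le_rfl, h⟩
    · exact ⟨N + 1, by omega, by rw [halt N le_rfl, h, Bool.not_true]⟩
  have hrej' : ∀ k, M.col s a (m + 2 * k) τ = false := by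
    intro k
    induction k with
    | zero => exact hrej
    | succ k ih =>
      rw [show m + 2 * (k + 1) = m + 2 * k + 1 + 1 by ring, halt _ (by omega),
        halt _ (by omega), ih]
      rfl
  have hprice : ∀ k : ℕ, M.chi (altAgent a m) τ * M.altPrice s a (m + 2 * k) τ =
      M.chi (altAgent a m) τ * M.altPrice s a m τ - k := by
    intro k
    induction k with
    | zero => simp
    | succ k ih =>
      have hsq := M.chi_mul_self (altAgent a m) τ
      rw [show m + 2 * (k + 1) = m + 2 * k + 2 by ring, altPrice_add_two, halt _ (by omega),
        hrej' k, altAgent_add_two_mul]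
      simp only [Bool.false_eq_true, if_false, Bool.not_false, if_true]
      push_cast
      linear_combination ih - hsq
  set D : Finset (Fin 2) := if c = true then {ω} else ∅ with hDdef
  have hτD : τ ∉ D := by
    cases c <;> simp [hDdef, hτ]
  have hD : ∀ k, M.demand (altAgent a m) (M.altPrice s a (m + 2 * k)) = D := by
    intro k
    ext x
    rw [← altAgent_add_two_mul a m k, ← col_eq_true_iff]
    rcases hcover x with rfl | rfl
    · rw [hc _ (by omega)]
      cases c <;> simp [hDdef]
    · simp [hrej' k, hτD]
  have hbound := fun k => M.v_insert_sub_le_of_demand_eq _ _ D (hD k) τ hτD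
  simp only [hprice] at hbound
  have hlarge := hbound (M.chi (altAgent a m) τ * M.altPrice s a m τ -
    (M.v (altAgent a m) (insert τ D) - M.v (altAgent a m) D) + 1).toNat
  omega

end Market

/-- In a two-agent market with two trades whose alternating best response
sequence does not terminate (and hence eventually cycles), every row of the cycle
contains at least one A and at least one R: arbitrarily late in the sequence each trade
is both accepted at some step and rejected at some step. -/
theorem cycle_row_contains_A_and_R
    (M : Market Bool (Fin 2)) (hN : M.Normalized)
    (s : MState Bool (Fin 2)) (a : Bool)
    (hnt : ¬ M.AltConverges s a) :
    ∀ (ω : Fin 2) (N : ℕ),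
      (∃ n, N ≤ n ∧ M.col s a n ω = true) ∧ (∃ n, N ≤ n ∧ M.col s a n ω = false) := by
  intro ω N
  obtain ⟨n, hn, h⟩ := M.exists_col_ne s a hnt ω N false
  obtain ⟨m, hm, h'⟩ := M.exists_col_ne s a hnt ω N true
  exact ⟨⟨n, hn, by simpa using h⟩, ⟨m, hm, by simpa using h'⟩⟩
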